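/- 𝓛(ε) has no nontrivial zero divisors; moreover, writing Z for the center of 𝓛(ε) and Q(Z) for its fraction field, the algebra Q(𝓛(ε)) := Q(Z) ⊗_Z 𝓛(ε) is a central simple algebra over Q(Z) (its center equals Q(Z) and it is a simple ring) of dimension l² as a Q(Z)-vector space; equivalently, Q(𝓛(ε)) is a division algebra of PI degree l. -/

import Mathlib

set_option synthInstance.maxHeartbeats 1000000

noncomputable section

variable (R : Type*) [CommRing R]

/-- Generators. -/
def gA : FreeAlgebra R (Fin 4) := FreeAlgebra.ι R 0
def gB : FreeAlgebra R (Fin 4) := FreeAlgebra.ι R 1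
def gC : FreeAlgebra R (Fin 4) := FreeAlgebra.ι R 2
def gD : FreeAlgebra R (Fin 4) := FreeAlgebra.ι R 3

/-- Defining relations of 𝓛₀,₁, with `s` standing for `q²` and `t` for `q⁻²`. -/
inductive LRel (s t : R) : FreeAlgebra R (Fin 4) → FreeAlgebra R (Fin 4) → Prop
  | rel1 : LRel s t (gA R * gD R) (gD R * gA R)
  | rel2 : LRel s t (gA R * gB R - gB R * gA R)
      (-(algebraMap R (FreeAlgebra R (Fin 4)) (1 - t) * (gB R * gD R)))
  | rel3 : LRel s t (gD R * gB R) (algebraMap R (FreeAlgebra R (Fin 4)) s * (gB R * gD R))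
  | rel4 : LRel s t (gC R * gB R - gB R * gC R)
      (algebraMap R (FreeAlgebra R (Fin 4)) (1 - t) * (gD R * gA R - gD R * gD R))
  | rel5 : LRel s t (gC R * gD R) (algebraMap R (FreeAlgebra R (Fin 4)) s * (gD R * gC R))
  | rel6 : LRel s t (gA R * gC R - gC R * gA R)
      (algebraMap R (FreeAlgebra R (Fin 4)) (1 - t) * (gD R * gC R))
  | rel7 : LRel s t (gA R * gD R - algebraMap R (FreeAlgebra R (Fin 4)) s * (gB R * gC R)) 1

/-- The quantum loop algebra with parameters `s = q²`, `t = q⁻²`. -/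
def QLoop (s t : R) : Type _ := RingQuot (LRel R s t)

instance (s t : R) : Ring (QLoop R s t) := RingQuot.instRing _
instance (s t : R) : Algebra R (QLoop R s t) := RingQuot.instAlgebra _

/-- The generators a, b, c, d of the quantum loop algebra. -/
def qa (s t : R) : QLoop R s t := RingQuot.mkAlgHom R (LRel R s t) (gA R)
def qb (s t : R) : QLoop R s t := RingQuot.mkAlgHom R (LRel R s t) (gB R)
def qc (s t : R) : QLoop R s t := RingQuot.mkAlgHom R (LRel R s t) (gC R)
def qd (s t : R) : QLoop R s t := RingQuot.mkAlgHom R (LRel R s t) (gD R)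

/-- The specialization 𝓛(q₀) at q = q₀ ∈ ℂ. -/
def Lspec (q₀ : ℂ) : Type := QLoop ℂ (q₀ ^ 2) ((q₀ ^ 2)⁻¹)

instance (q₀ : ℂ) : Ring (Lspec q₀) := inferInstanceAs (Ring (QLoop ℂ _ _))
instance (q₀ : ℂ) : Algebra ℂ (Lspec q₀) := inferInstanceAs (Algebra ℂ (QLoop ℂ _ _))


/-- The generators a, b, c, d of 𝓛(q₀). -/
def la (q₀ : ℂ) : Lspec q₀ := qa ℂ (q₀ ^ 2) ((q₀ ^ 2)⁻¹)
def lb (q₀ : ℂ) : Lspec q₀ := qb ℂ (q₀ ^ 2) ((q₀ ^ 2)⁻¹)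
def lc (q₀ : ℂ) : Lspec q₀ := qc ℂ (q₀ ^ 2) ((q₀ ^ 2)⁻¹)
def ld (q₀ : ℂ) : Lspec q₀ := qd ℂ (q₀ ^ 2) ((q₀ ^ 2)⁻¹)

/-- The central element ω := q₀·a + q₀⁻¹·d of 𝓛(q₀). -/
def omegaL (q₀ : ℂ) : Lspec q₀ :=
  algebraMap ℂ (Lspec q₀) q₀ * la q₀ + algebraMap ℂ (Lspec q₀) q₀⁻¹ * ld q₀

open scoped TensorProduct

/-- The center `Z` of 𝓛(ε). -/
abbrev ZL (ε : ℂ) := Subring.center (Lspec ε)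

/-- The fraction field `Q(Z)` of the center of 𝓛(ε). -/
abbrev QZL (ε : ℂ) := FractionRing (ZL ε)

/-- `Q(𝓛(ε)) := Q(Z) ⊗_Z 𝓛(ε)`. -/
abbrev QLL (ε : ℂ) := (QZL ε) ⊗[ZL ε] (Lspec ε)


section SkewMonoidAlgebra

variable {k G : Type*} [Semiring k]

/-- A coefficient of a product in a skew monoid algebra that is reached in a unique way as a product
of elements of the supports is a twisted product of coefficients. -/
theorem SkewMonoidAlgebra.coeff_mul_of_uniqueMul [Monoid G] [MulSemiringAction G k]
    {f g : SkewMonoidAlgebra k G} {x y : G} (h : UniqueMul f.support g.support x y) :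
    (f * g).coeff (x * y) = f.coeff x * x • g.coeff y := by
  classical
  simp_rw [coeff_mul, sum_def, Finsupp.sum, ← Finset.sum_product']
  refine (Finset.sum_eq_single (x, y) ?_ ?_).trans (if_pos rfl) <;> simp_rw [Finset.mem_product]
  · refine fun ab hab hne ↦ if_neg (fun he ↦ hne <| Prod.ext ?_ ?_)
    exacts [(h hab.1 hab.2 he).1, (h hab.1 hab.2 he).2]
  · refine fun hnotMem ↦ ite_eq_right_iff.mpr (fun _ ↦ ?_)
    rcases not_and_or.mp hnotMem with af | bg
    · rw [Finsupp.notMem_support_iff.mp af, zero_mul]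
    · rw [Finsupp.notMem_support_iff.mp bg, smul_zero, mul_zero]

instance SkewMonoidAlgebra.instNoZeroDivisors [NoZeroDivisors k] [Group G] [UniqueProds G]
    [MulSemiringAction G k] : NoZeroDivisors (SkewMonoidAlgebra k G) where
  eq_zero_or_eq_zero_of_mul_eq_zero {a b} hab := by
    contrapose! hab
    have h1 : a.support.Nonempty := by
      simpa [Finset.nonempty_iff_ne_empty, support_eq_empty] using hab.1
    have h2 : b.support.Nonempty := by
      simpa [Finset.nonempty_iff_ne_empty, support_eq_empty] using hab.2
    obtain ⟨x, hx, y, hy, h⟩ := UniqueProds.uniqueMul_of_nonempty h1 h2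
    rw [mem_support_iff] at hx hy
    intro h0
    have h3 := coeff_mul_of_uniqueMul h
    rw [h0, coeff_zero, Finsupp.zero_apply] at h3
    exact mul_ne_zero hx (by rwa [Ne, smul_eq_zero_iff_eq]) h3.symm

end SkewMonoidAlgebra

section CentralLocalization

variable (A : Type*) [Ring A] [IsDomain A]

local notation "Z" => Subring.center A
local notation "K" => FractionRing (Subring.center A)
local notation "Q" => FractionRing (Subring.center A) ⊗[Subring.center A] A

instance centralLocalization_isLocalizedModule :
    IsLocalizedModule (nonZeroDivisors Z) (TensorProduct.mk Z K A 1) :=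
  (isLocalizedModule_iff_isBaseChange (nonZeroDivisors Z) K _).2 (TensorProduct.isBaseChange Z A K)

/-- Every element of `Q(Z) ⊗ A` is a fraction with central denominator. -/
theorem centralLocalization_surj (x : Q) :
    ∃ (z : Z) (a : A), z ≠ 0 ∧
      algebraMap K Q (algebraMap Z K z) * x = Algebra.TensorProduct.includeRight a := by
  obtain ⟨⟨a, z⟩, h⟩ := IsLocalizedModule.surj (nonZeroDivisors Z) (TensorProduct.mk Z K A 1) x
  refine ⟨z, a, nonZeroDivisors.coe_ne_zero z, ?_⟩
  rw [← Algebra.smul_def, algebraMap_smul]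
  exact h

theorem centralLocalization_injective :
    Function.Injective (Algebra.TensorProduct.includeRight : A →ₐ[Z] Q) := by
  rw [injective_iff_map_eq_zero]
  intro a ha
  obtain ⟨c, hc⟩ := (IsLocalizedModule.eq_zero_iff (nonZeroDivisors Z)
    (TensorProduct.mk Z K A 1)).1 ha
  have h : ((c : Z) : A) * a = 0 := hc
  refine (mul_eq_zero.1 h).resolve_left fun h0 => nonZeroDivisors.coe_ne_zero c (Subtype.ext h0)

instance centralLocalization_nontrivial : Nontrivial Q :=
  (centralLocalization_injective A).nontrivial

theorem centralLocalization_isDomain : IsDomain Q := by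
  have : NoZeroDivisors Q := by
    refine ⟨fun {x y} hxy => ?_⟩
    obtain ⟨z, a, hz, hx⟩ := centralLocalization_surj A x
    obtain ⟨w, b, hw, hy⟩ := centralLocalization_surj A y
    have hab : a * b = 0 := by
      apply centralLocalization_injective A
      rw [map_mul, ← hx, ← hy, mul_assoc, ← mul_assoc x, ← Algebra.commutes _ x, mul_assoc _ x, hxy]
      simp
    have key : ∀ {u : Z} {v : Q}, u ≠ 0 → algebraMap K Q (algebraMap Z K u) * v = 0 → v = 0 := by
      intro u v hu huv
      rw [← Algebra.smul_def] at huv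
      refine (smul_eq_zero.1 huv).resolve_left ?_
      rw [map_eq_zero_iff _ (IsFractionRing.injective Z K)]
      exact hu
    rcases mul_eq_zero.1 hab with rfl | rfl
    · exact Or.inl (key hz (by rw [hx, map_zero]))
    · exact Or.inr (key hw (by rw [hy, map_zero]))
  exact NoZeroDivisors.to_isDomain _

theorem center_centralLocalization : Subring.center Q = (algebraMap K Q).range := by
  ext x
  constructor
  · intro hx
    obtain ⟨z, a, hz, h⟩ := centralLocalization_surj A x
    have ha : a ∈ Subring.center A := by
      rw [Subring.mem_center_iff]
      intro g
      apply centralLocalization_injective A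
      rw [map_mul, map_mul, ← h, mul_assoc, ← Subring.mem_center_iff.1 hx, ← mul_assoc,
        ← mul_assoc, Algebra.commutes]
    refine ⟨(algebraMap Z K z)⁻¹ * algebraMap Z K ⟨a, ha⟩, ?_⟩
    have hz' : algebraMap Z K z ≠ 0 := by
      rw [Ne, map_eq_zero_iff _ (IsFractionRing.injective Z K)]
      exact hz
    have h1 : algebraMap K Q (algebraMap Z K ⟨a, ha⟩) = Algebra.TensorProduct.includeRight a := by
      rw [← IsScalarTower.algebraMap_apply]
      exact (Algebra.TensorProduct.includeRight.commutes (⟨a, ha⟩ : Z)).symm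
    rw [map_mul, h1, ← h, ← mul_assoc, ← map_mul, inv_mul_cancel₀ hz', map_one, one_mul]
  · rintro ⟨r, rfl⟩
    rw [Subring.mem_center_iff]
    intro g
    exact (Algebra.commutes r g).symm

end CentralLocalization

section QuantumTorus

variable {K Q : Type*} [Field K] [Ring Q] [Algebra K Q]

theorem pow_mul_of_qcommute {ζ : K} {x y : Q} (h : y * x = ζ • (x * y)) (i : ℕ) :
    y * x ^ i = ζ ^ i • (x ^ i * y) := by
  induction i with
  | zero => simp
  | succ i ih =>
    rw [pow_succ, ← mul_assoc, ih, smul_mul_assoc, mul_assoc, h, mul_smul_comm, smul_smul,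
      ← mul_assoc, pow_succ]

theorem mul_pow_of_qcommute {ζ : K} {x y : Q} (h : y * x = ζ • (x * y)) (i : ℕ) :
    y ^ i * x = ζ ^ i • (x * y ^ i) := by
  induction i with
  | zero => simp
  | succ i ih =>
    rw [pow_succ, mul_assoc, h, mul_smul_comm, ← mul_assoc, ih, smul_mul_assoc, smul_smul,
      mul_assoc, pow_succ, mul_comm ζ]

variable {l : ℕ} {ζ β δ : K} {x y : Q}

theorem linearIndependent_of_qcommute [IsDomain Q] (hl : 0 < l) (hζ : IsPrimitiveRoot ζ l)
    (h : y * x = ζ • (x * y)) (hx : x ^ l = algebraMap K Q β) (hy : y ^ l = algebraMap K Q δ)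
    (hx0 : x ≠ 0) (hy0 : y ≠ 0) :
    LinearIndependent K fun p : Fin l × Fin l => x ^ (p.1 : ℕ) * y ^ (p.2 : ℕ) := by
  have hβ : β ≠ 0 := by
    rintro rfl
    exact pow_ne_zero l hx0 (by rw [hx, map_zero])
  have hδ : δ ≠ 0 := by
    rintro rfl
    exact pow_ne_zero l hy0 (by rw [hy, map_zero])
  obtain ⟨m, rfl⟩ : ∃ m, l = m + 1 := ⟨l - 1, by omega⟩
  have hinj : Function.Injective fun i : Fin (m + 1) => ζ ^ (i : ℕ) * δ := by
    intro i j hij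
    exact Fin.ext (hζ.pow_inj i.2 j.2 (mul_right_cancel₀ hδ hij))
  have hinj' : Function.Injective fun j : Fin (m + 1) => (ζ ^ m) ^ (j : ℕ) * β := by
    intro i j hij
    have hζ' : IsPrimitiveRoot (ζ ^ m) (m + 1) :=
      hζ.pow_of_coprime m (by simp)
    exact Fin.ext (hζ'.pow_inj i.2 j.2 (mul_right_cancel₀ hβ hij))
  let T₁ : Module.End K Q := LinearMap.mulLeft K y ∘ₗ LinearMap.mulRight K (y ^ m)
  let T₂ : Module.End K Q := LinearMap.mulLeft K x ∘ₗ LinearMap.mulRight K (x ^ m)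
  have e₁ : ∀ i j : ℕ, T₁ (x ^ i * y ^ j) = (ζ ^ i * δ) • (x ^ i * y ^ j) := by
    intro i j
    change y * (x ^ i * y ^ j * y ^ m) = _
    have : y * (x ^ i * y ^ j * y ^ m) = (y * x ^ i) * (y ^ j * y ^ m) := by simp only [mul_assoc]
    rw [this, pow_mul_of_qcommute h, smul_mul_assoc, mul_assoc, ← pow_add, ← pow_succ',
      add_assoc, pow_add, hy, ← Algebra.commutes, mul_smul, ← Algebra.smul_def, mul_smul_comm]
  have e₂ : ∀ i j : ℕ, T₂ (x ^ i * y ^ j) = ((ζ ^ m) ^ j * β) • (x ^ i * y ^ j) := by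
    intro i j
    change x * (x ^ i * y ^ j * x ^ m) = _
    have h2 : y ^ j * x ^ m = (ζ ^ m) ^ j • (x ^ m * y ^ j) :=
      mul_pow_of_qcommute (pow_mul_of_qcommute h m) j
    have h3 : x * (x ^ i * (x ^ m * y ^ j)) = x ^ (m + 1) * (x ^ i * y ^ j) := by
      simp only [← mul_assoc, ← pow_succ', ← pow_add]
      congr 2
      omega
    rw [mul_assoc, h2, mul_smul_comm, mul_smul_comm, h3, hx, ← Algebra.smul_def, mul_smul]
  have li₂ : LinearIndependent K fun j : Fin (m + 1) => y ^ (j : ℕ) := by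
    refine Module.End.eigenvectors_linearIndependent' T₂ _ hinj' _ fun j => ?_
    refine ⟨Module.End.mem_eigenspace_iff.2 ?_, pow_ne_zero _ hy0⟩
    simpa using e₂ 0 j
  rw [Fintype.linearIndependent_iff]
  intro g hg
  have hind := (Module.End.eigenspaces_iSupIndep T₁).comp hinj
  have hw : ∀ i : Fin (m + 1), ∑ j, g (i, j) • (x ^ (i : ℕ) * y ^ (j : ℕ)) = 0 := by
    rw [Fintype.sum_prod_type] at hg
    have hmem : ∀ i : Fin (m + 1), ∑ j, g (i, j) • (x ^ (i : ℕ) * y ^ (j : ℕ)) ∈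
        T₁.eigenspace (ζ ^ (i : ℕ) * δ) := fun i =>
      Submodule.sum_mem _ fun j _ => Submodule.smul_mem _ _
        (Module.End.mem_eigenspace_iff.2 (e₁ i j))
    intro i
    exact (iSupIndep_iff_finsetSum_eq_zero_imp_eq_zero _).1 hind Finset.univ _
      (fun i _ => hmem i) hg i (Finset.mem_univ _)
  rintro ⟨i, j⟩
  refine Fintype.linearIndependent_iff.1 li₂ (fun j => g (i, j)) ?_ j
  have := hw i
  simp_rw [← mul_smul_comm, ← Finset.mul_sum] at this
  exact (mul_eq_zero.1 this).resolve_left (pow_ne_zero _ hx0)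

theorem span_eq_top_of_qcommute (hl : 0 < l)
    (h : y * x = ζ • (x * y)) (hx : x ^ l = algebraMap K Q β) (hy : y ^ l = algebraMap K Q δ)
    (hgen : Algebra.adjoin K {x, y} = ⊤) :
    Submodule.span K (Set.range fun p : Fin l × Fin l => x ^ (p.1 : ℕ) * y ^ (p.2 : ℕ)) = ⊤ := by
  set V := Submodule.span K (Set.range fun p : Fin l × Fin l => x ^ (p.1 : ℕ) * y ^ (p.2 : ℕ))
    with hV
  have hmem : ∀ i j : ℕ, x ^ i * y ^ j ∈ V := by
    intro i j
    have h1 : ∀ (i : ℕ), x ^ i = (β ^ (i / l)) • x ^ (i % l) := by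
      intro i
      conv_lhs => rw [← Nat.div_add_mod i l, pow_add, pow_mul, hx, ← map_pow, ← Algebra.smul_def]
    have h2 : ∀ (i : ℕ), y ^ i = (δ ^ (i / l)) • y ^ (i % l) := by
      intro i
      conv_lhs => rw [← Nat.div_add_mod i l, pow_add, pow_mul, hy, ← map_pow, ← Algebra.smul_def]
    rw [h1 i, h2 j, smul_mul_smul_comm]
    exact V.smul_mem _ (Submodule.subset_span
      ⟨(⟨i % l, Nat.mod_lt _ hl⟩, ⟨j % l, Nat.mod_lt _ hl⟩), rfl⟩)
  have hmul : ∀ q : Q, ∀ v ∈ V, q * v ∈ V := by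
    intro q
    have hq : q ∈ Algebra.adjoin K {x, y} := hgen ▸ Algebra.mem_top
    induction hq using Algebra.adjoin_induction with
    | mem u hu =>
      intro v hv
      induction hv using Submodule.span_induction with
      | mem v hv =>
        obtain ⟨p, rfl⟩ := hv
        rcases hu with rfl | rfl
        · simpa only [← mul_assoc, ← pow_succ'] using hmem (p.1 + 1) p.2
        · simp only [← mul_assoc]
          rw [pow_mul_of_qcommute h, smul_mul_assoc, mul_assoc, ← pow_succ']
          exact V.smul_mem _ (hmem _ _)
      | zero => simp
      | add a b _ _ ha hb => rw [mul_add]; exact V.add_mem ha hb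
      | smul r a _ ha => rw [mul_smul_comm]; exact V.smul_mem _ ha
    | algebraMap r => intro v hv; rw [← Algebra.smul_def]; exact V.smul_mem _ hv
    | add a b _ _ ha hb => intro v hv; rw [add_mul]; exact V.add_mem (ha v hv) (hb v hv)
    | mul a b _ _ ha hb => intro v hv; rw [mul_assoc]; exact ha _ (hb v hv)
  rw [eq_top_iff]
  intro q _
  simpa using hmul q 1 (by simpa using hmem 0 0)

/-- A domain generated over `K` by two elements that commute up to a primitive `l`-th root of unity
and whose `l`-th powers are scalars has a basis of `l ^ 2` monomials. -/
def basisOfQCommute [IsDomain Q] (hl : 0 < l) (hζ : IsPrimitiveRoot ζ l)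
    (h : y * x = ζ • (x * y)) (hx : x ^ l = algebraMap K Q β) (hy : y ^ l = algebraMap K Q δ)
    (hx0 : x ≠ 0) (hy0 : y ≠ 0) (hgen : Algebra.adjoin K {x, y} = ⊤) :
    Module.Basis (Fin l × Fin l) K Q :=
  Module.Basis.mk (linearIndependent_of_qcommute hl hζ h hx hy hx0 hy0)
    (span_eq_top_of_qcommute hl h hx hy hgen).ge

end QuantumTorus

section Presentation

variable {q : ℂ}

theorem la_mul_ld : la q * ld q = ld q * la q := by
  have := RingQuot.mkAlgHom_rel ℂ (LRel.rel1 (R := ℂ) (s := q ^ 2) (t := (q ^ 2)⁻¹))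
  simp only [map_mul] at this
  exact this

theorem la_mul_lb_sub :
    la q * lb q - lb q * la q =
      -(algebraMap ℂ (Lspec q) (1 - (q ^ 2)⁻¹) * (lb q * ld q)) := by
  have := RingQuot.mkAlgHom_rel ℂ (LRel.rel2 (R := ℂ) (s := q ^ 2) (t := (q ^ 2)⁻¹))
  simp only [map_mul, map_sub, map_neg, AlgHom.commutes] at this ⊢
  exact this

theorem ld_mul_lb : ld q * lb q = algebraMap ℂ (Lspec q) (q ^ 2) * (lb q * ld q) := by
  have := RingQuot.mkAlgHom_rel ℂ (LRel.rel3 (R := ℂ) (s := q ^ 2) (t := (q ^ 2)⁻¹))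
  simp only [map_mul, AlgHom.commutes] at this
  exact this

theorem lc_mul_lb_sub :
    lc q * lb q - lb q * lc q =
      algebraMap ℂ (Lspec q) (1 - (q ^ 2)⁻¹) * (ld q * la q - ld q * ld q) := by
  have := RingQuot.mkAlgHom_rel ℂ (LRel.rel4 (R := ℂ) (s := q ^ 2) (t := (q ^ 2)⁻¹))
  simp only [map_mul, map_sub, AlgHom.commutes] at this ⊢
  exact this

theorem lc_mul_ld : lc q * ld q = algebraMap ℂ (Lspec q) (q ^ 2) * (ld q * lc q) := by
  have := RingQuot.mkAlgHom_rel ℂ (LRel.rel5 (R := ℂ) (s := q ^ 2) (t := (q ^ 2)⁻¹))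
  simp only [map_mul, AlgHom.commutes] at this
  exact this

theorem la_mul_lc_sub :
    la q * lc q - lc q * la q = algebraMap ℂ (Lspec q) (1 - (q ^ 2)⁻¹) * (ld q * lc q) := by
  have := RingQuot.mkAlgHom_rel ℂ (LRel.rel6 (R := ℂ) (s := q ^ 2) (t := (q ^ 2)⁻¹))
  simp only [map_mul, map_sub, AlgHom.commutes] at this ⊢
  exact this

theorem la_mul_ld_sub :
    la q * ld q - algebraMap ℂ (Lspec q) (q ^ 2) * (lb q * lc q) = 1 := by
  have := RingQuot.mkAlgHom_rel ℂ (LRel.rel7 (R := ℂ) (s := q ^ 2) (t := (q ^ 2)⁻¹))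
  simp only [map_mul, map_sub, map_one, AlgHom.commutes] at this
  exact this

/-- Induction on elements of `𝓛(q)` along the generators. -/
theorem Lspec.induction {P : Lspec q → Prop} (scalar : ∀ r, P (algebraMap ℂ (Lspec q) r))
    (ha : P (la q)) (hb : P (lb q)) (hc : P (lc q)) (hd : P (ld q))
    (add : ∀ x y, P x → P y → P (x + y)) (mul : ∀ x y, P x → P y → P (x * y)) (x : Lspec q) :
    P x := by
  obtain ⟨f, rfl⟩ := RingQuot.mkAlgHom_surjective ℂ (LRel ℂ (q ^ 2) ((q ^ 2)⁻¹)) x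
  induction f using FreeAlgebra.induction with
  | grade0 r =>
    rw [AlgHom.commutes]
    exact scalar r
  | grade1 i =>
    fin_cases i
    exacts [ha, hb, hc, hd]
  | mul f g hf hg => rw [map_mul]; exact mul _ _ hf hg
  | add f g hf hg => rw [map_add]; exact add _ _ hf hg

/-- A rescaling of the central element `omegaL q`. -/
def lw (q : ℂ) : Lspec q := q ^ 2 • la q + ld q

theorem la_eq (hq : q ≠ 0) : la q = (q ^ 2)⁻¹ • (lw q - ld q) := by
  rw [lw, add_sub_cancel_right, smul_smul, inv_mul_cancel₀ (pow_ne_zero 2 hq), one_smul]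

theorem ld_mul_lb_smul : ld q * lb q = q ^ 2 • (lb q * ld q) := by
  rw [ld_mul_lb, Algebra.smul_def]

theorem lc_mul_ld_smul : lc q * ld q = q ^ 2 • (ld q * lc q) := by
  rw [lc_mul_ld, Algebra.smul_def]

theorem lw_mul_ld : lw q * ld q = ld q * lw q := by
  simp only [lw, add_mul, mul_add, smul_mul_assoc, mul_smul_comm, la_mul_ld]

theorem lw_mul_la : lw q * la q = la q * lw q := by
  simp only [lw, add_mul, mul_add, smul_mul_assoc, mul_smul_comm, la_mul_ld]

theorem lw_mul_lb (hq : q ≠ 0) : lw q * lb q = lb q * lw q := by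
  have h := la_mul_lb_sub (q := q)
  rw [← Algebra.smul_def, sub_eq_iff_eq_add] at h
  simp only [lw, add_mul, mul_add, smul_mul_assoc, mul_smul_comm, h, ld_mul_lb_smul]
  match_scalars <;> field_simp
  ring

theorem lw_mul_lc (hq : q ≠ 0) : lw q * lc q = lc q * lw q := by
  have h := la_mul_lc_sub (q := q)
  rw [← Algebra.smul_def, sub_eq_iff_eq_add] at h
  simp only [lw, add_mul, mul_add, smul_mul_assoc, mul_smul_comm, h, lc_mul_ld_smul]
  match_scalars <;> field_simp
  ring

theorem lb_mul_lc (hq : q ≠ 0) : lb q * lc q =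
    ((q ^ 2)⁻¹) ^ 2 • (lw q * ld q) - ((q ^ 2)⁻¹) ^ 2 • (ld q * ld q) - (q ^ 2)⁻¹ • 1 := by
  have h := la_mul_ld_sub (q := q)
  rw [← Algebra.smul_def, sub_eq_iff_eq_add'] at h
  have h2 : lb q * lc q = (q ^ 2)⁻¹ • (la q * ld q - 1) := by
    rw [h, add_sub_cancel_right, smul_smul, inv_mul_cancel₀ (pow_ne_zero 2 hq), one_smul]
  rw [h2, la_eq hq]
  simp only [sub_mul, smul_mul_assoc, smul_sub, smul_smul, sq]

theorem lc_mul_lb (hq : q ≠ 0) : lc q * lb q =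
    (q ^ 2)⁻¹ • (lw q * ld q) - ld q * ld q - (q ^ 2)⁻¹ • 1 := by
  have h := lc_mul_lb_sub (q := q)
  rw [← Algebra.smul_def, sub_eq_iff_eq_add, lb_mul_lc hq, la_eq hq] at h
  rw [h]
  simp only [mul_smul_comm, mul_sub, lw_mul_ld]
  match_scalars <;> field_simp <;> ring

theorem lw_mem_center (hq : q ≠ 0) : lw q ∈ Subring.center (Lspec q) := by
  rw [Subring.mem_center_iff]
  intro g
  induction g using Lspec.induction with
  | scalar r => exact Algebra.commutes _ _
  | ha => exact lw_mul_la.symm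
  | hb => exact (lw_mul_lb hq).symm
  | hc => exact (lw_mul_lc hq).symm
  | hd => exact lw_mul_ld.symm
  | add x y hx hy => rw [add_mul, mul_add, hx, hy]
  | mul x y hx hy => rw [mul_assoc, hy, ← mul_assoc, hx, mul_assoc]

end Presentation

section Embedding

open Polynomial

/-- The polynomial ring `ℂ[ω][d]` with the automorphism `d ↦ u d`. -/
def TwistedPoly (_u : ℂˣ) : Type := ℂ[X][X]

variable (u : ℂˣ)

instance : CommRing (TwistedPoly u) := inferInstanceAs (CommRing ℂ[X][X])
instance : IsDomain (TwistedPoly u) := inferInstanceAs (IsDomain ℂ[X][X])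
instance : Algebra ℂ (TwistedPoly u) := inferInstanceAs (Algebra ℂ ℂ[X][X])

/-- The variable `ω`. -/
def TwistedPoly.w : TwistedPoly u := (C X : ℂ[X][X])

/-- The variable `d`. -/
def TwistedPoly.d : TwistedPoly u := (X : ℂ[X][X])

/-- The automorphism `d ↦ u d`. -/
def TwistedPoly.twist : TwistedPoly u ≃ₐ[ℂ] TwistedPoly u :=
  letI : Invertible (C (u : ℂ) : ℂ[X]) := (u.isUnit.map C).invertible
  (algEquivCMulXAddC (C (u : ℂ)) 0).restrictScalars ℂ

theorem TwistedPoly.twist_w : twist u (w u) = w u := by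
  let : Invertible (C (u : ℂ) : ℂ[X]) := (u.isUnit.map C).invertible
  change algEquivCMulXAddC (C (u : ℂ)) 0 (C X : ℂ[X][X]) = C X
  simp [algEquivCMulXAddC_apply]

theorem TwistedPoly.twist_d : twist u (d u) = (u : ℂ) • d u := by
  let : Invertible (C (u : ℂ) : ℂ[X]) := (u.isUnit.map C).invertible
  change algEquivCMulXAddC (C (u : ℂ)) 0 (X : ℂ[X][X]) = (u : ℂ) • X
  rw [algEquivCMulXAddC_apply]
  simp only [aeval_X, map_zero, add_zero]
  exact (Algebra.smul_def (A := ℂ[X][X]) (u : ℂ) X).symm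

@[elab_as_elim]
theorem TwistedPoly.induction {P : TwistedPoly u → Prop}
    (scalar : ∀ r, P (algebraMap ℂ (TwistedPoly u) r)) (hw : P (w u)) (hd : P (d u))
    (add : ∀ x y, P x → P y → P (x + y)) (mul : ∀ x y, P x → P y → P (x * y))
    (x : TwistedPoly u) : P x := by
  have hpow : ∀ y n, P y → P (y ^ n) := by
    intro y n hy
    induction n with
    | zero => simpa using scalar 1
    | succ n ih => rw [pow_succ]; exact mul _ _ ih hy
  have hC : ∀ f : ℂ[X], P (C f : ℂ[X][X]) := by
    intro f
    induction f using Polynomial.induction_on' with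
    | add f g hf hg => rw [C_add]; exact add _ _ hf hg
    | monomial n r =>
      rw [← C_mul_X_pow_eq_monomial, C_mul, C_pow]
      exact mul _ _ (scalar r) (hpow _ n hw)
  refine Polynomial.induction_on' (motive := P) x add fun n f => ?_
  rw [← C_mul_X_pow_eq_monomial]
  exact mul _ _ (hC f) (hpow _ n hd)

instance : MulSemiringAction (Multiplicative ℤ) (TwistedPoly u) :=
  MulSemiringAction.compHom _ (zpowersHom (TwistedPoly u ≃ₐ[ℂ] TwistedPoly u) (TwistedPoly.twist u))

theorem TwistedPoly.ofAdd_smul (n : ℤ) (f : TwistedPoly u) :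
    Multiplicative.ofAdd n • f = (twist u ^ n) f := rfl

instance : SMulCommClass (Multiplicative ℤ) ℂ (TwistedPoly u) where
  smul_comm n r f := map_smul (zpowersHom _ (TwistedPoly.twist u) n) r f

/-- The polynomial `u ω d - d² - u`. -/
def TwistedPoly.p : TwistedPoly u :=
  (u : ℂ) • (w u * d u) - d u * d u - (u : ℂ) • 1

theorem TwistedPoly.p_ne_zero : p u ≠ 0 := by
  intro h
  have h2 : (Polynomial.coeff (R := ℂ[X]) (p u) 0) = - C (u : ℂ) := by
    have : ∀ r : ℂ, ((r • ((C X : ℂ[X][X]) * X) - X * X - r • 1) : ℂ[X][X]).coeff 0 = -C r := by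
      intro r
      simp [Polynomial.smul_eq_C_mul]
    exact this u
  rw [h] at h2
  have h3 : (0 : ℂ[X]) = - C (u : ℂ) := h2
  exact u.ne_zero (by simpa using h3.symm)

theorem TwistedPoly.twist_p : twist u (p u) =
    ((u : ℂ) ^ 2) • (w u * d u) - ((u : ℂ) ^ 2) • (d u * d u) - (u : ℂ) • 1 := by
  rw [p]
  simp only [map_sub, map_smul, map_mul, twist_w, twist_d, map_one, mul_smul_comm, smul_mul_assoc,
    smul_smul, sq]

/-- The skew Laurent polynomial ring over `ℂ[ω][d]`. -/
abbrev SkewTorus := SkewMonoidAlgebra (TwistedPoly u) (Multiplicative ℤ)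

theorem SkewMonoidAlgebra.single_sub {k G : Type*} [AddGroup k] (g : G) (x y : k) :
    single g (x - y) = single g x - single g y := by
  rw [sub_eq_add_neg, single_add, single_neg, sub_eq_add_neg]

variable {q : ℂ} (hq : q ≠ 0)

/-- The unit `q⁻²`. -/
def qInvSq : ℂˣ := (Units.mk0 q hq ^ 2)⁻¹

theorem coe_qInvSq : (qInvSq hq : ℂ) = (q ^ 2)⁻¹ := by
  simp [qInvSq]

open SkewMonoidAlgebra in
/-- The images of the generators `a, b, c, d` in the skew Laurent polynomial ring. -/
def torusGen : Fin 4 → SkewTorus u :=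
  ![single 1 ((u : ℂ) • (TwistedPoly.w u - TwistedPoly.d u)),
    single (Multiplicative.ofAdd 1) 1,
    single (Multiplicative.ofAdd (-1)) (TwistedPoly.p u),
    single 1 (TwistedPoly.d u)]

theorem TwistedPoly.twist_symm_d : (twist u).symm (d u) = (u : ℂ)⁻¹ • d u := by
  rw [AlgEquiv.symm_apply_eq, map_smul, twist_d, smul_smul, inv_mul_cancel₀ u.ne_zero, one_smul]

theorem TwistedPoly.twist_symm_w : (twist u).symm (w u) = w u := by
  rw [AlgEquiv.symm_apply_eq, twist_w]

theorem TwistedPoly.ofAdd_one_smul (f : TwistedPoly u) :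
    Multiplicative.ofAdd (1 : ℤ) • f = twist u f := by
  rw [ofAdd_smul, zpow_one]

theorem TwistedPoly.ofAdd_neg_one_smul (f : TwistedPoly u) :
    Multiplicative.ofAdd (-1 : ℤ) • f = (twist u).symm f := by
  rw [ofAdd_smul, zpow_neg_one]
  rfl

open SkewMonoidAlgebra TwistedPoly in
set_option maxHeartbeats 1000000 in
theorem torusGen_rel (x y : FreeAlgebra ℂ (Fin 4)) (h : LRel ℂ (q ^ 2) ((q ^ 2)⁻¹) x y) :
    FreeAlgebra.lift ℂ (torusGen (qInvSq hq)) x = FreeAlgebra.lift ℂ (torusGen (qInvSq hq)) y := by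
  have hu := coe_qInvSq hq
  have e1 : ∀ n : ℤ, (1 : Multiplicative ℤ) * Multiplicative.ofAdd n = Multiplicative.ofAdd n :=
    fun n => one_mul _
  have e2 : Multiplicative.ofAdd (1 : ℤ) * Multiplicative.ofAdd (-1) = 1 := rfl
  have e3 : Multiplicative.ofAdd (-1 : ℤ) * Multiplicative.ofAdd 1 = 1 := rfl
  cases h <;>
  simp only [gA, gB, gC, gD, map_mul, map_sub, map_neg, map_one,
    FreeAlgebra.lift_ι_apply, torusGen, Matrix.cons_val, single_mul_single, one_smul, one_mul,
    mul_one, ← Algebra.smul_def, smul_single, ofAdd_one_smul, ofAdd_neg_one_smul, twist_p,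
    twist_w, twist_d, twist_symm_w, twist_symm_d, e2, e3, ← SkewMonoidAlgebra.single_sub,
    ← single_neg, hu,
    map_smul, smul_one, one_def, inv_inv, sub_mul] <;>
  congr 1 <;> try simp only [p, hu]
  all_goals
    have hts : algebraMap ℂ (TwistedPoly (qInvSq hq)) (q ^ 2)⁻¹ *
        algebraMap ℂ (TwistedPoly (qInvSq hq)) (q ^ 2) = 1 := by
      rw [← map_mul, inv_mul_cancel₀ (pow_ne_zero 2 hq), map_one]
    simp only [Algebra.smul_def, map_pow _ (q ^ 2)⁻¹] at hts ⊢
    generalize algebraMap ℂ (TwistedPoly (qInvSq hq)) (q ^ 2)⁻¹ = T at *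
    generalize algebraMap ℂ (TwistedPoly (qInvSq hq)) (q ^ 2) = S at *
    generalize w (qInvSq hq) = w at *
    generalize d (qInvSq hq) = d at *
    clear hu e1 e2 e3
    first
    | ring1
    | linear_combination -d * hts
    | linear_combination d * (T * (w * d) - d * d - T) * hts
    | linear_combination (1 - T * w * d + T * d * d) * hts

/-- The homomorphism from `𝓛(q)` to the skew Laurent polynomial ring. -/
def toTorus : Lspec q →ₐ[ℂ] SkewTorus (qInvSq hq) :=
  RingQuot.liftAlgHom ℂ ⟨FreeAlgebra.lift ℂ (torusGen (qInvSq hq)), torusGen_rel hq⟩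

theorem toTorus_mkAlgHom (i : Fin 4) :
    toTorus hq (RingQuot.mkAlgHom ℂ (LRel ℂ (q ^ 2) ((q ^ 2)⁻¹)) (FreeAlgebra.ι ℂ i)) =
      torusGen (qInvSq hq) i := by
  rw [toTorus]
  refine (RingQuot.liftAlgHom_mkAlgHom_apply ℂ _ _ _).trans ?_
  exact FreeAlgebra.lift_ι_apply _ _

open SkewMonoidAlgebra TwistedPoly

theorem toTorus_lb : toTorus hq (lb q) = single (Multiplicative.ofAdd 1) 1 := toTorus_mkAlgHom hq 1

theorem toTorus_lc : toTorus hq (lc q) = single (Multiplicative.ofAdd (-1)) (p (qInvSq hq)) :=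
  toTorus_mkAlgHom hq 2

theorem toTorus_ld : toTorus hq (ld q) = single 1 (d (qInvSq hq)) := toTorus_mkAlgHom hq 3

theorem toTorus_lw : toTorus hq (lw q) = single 1 (w (qInvSq hq)) := by
  have ha : toTorus hq (la q) =
      single 1 ((qInvSq hq : ℂ) • (w (qInvSq hq) - d (qInvSq hq))) := toTorus_mkAlgHom hq 0
  rw [lw, map_add, map_smul, ha, toTorus_ld, smul_single, smul_smul, coe_qInvSq,
    mul_inv_cancel₀ (pow_ne_zero 2 hq), one_smul, ← single_add, sub_add_cancel]

/-- The homomorphism `ℂ[ω][d] → 𝓛(q)`. -/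
def polyToLspec (q : ℂ) : TwistedPoly u →+* Lspec q :=
  eval₂RingHom' (aeval (lw q) : ℂ[X] →ₐ[ℂ] Lspec q).toRingHom (ld q) fun f => by
    induction f using Polynomial.induction_on' with
    | add f g hf hg => rw [map_add]; exact hf.add_left hg
    | monomial n r =>
      have h : Commute (lw q) (ld q) := lw_mul_ld
      change Commute (aeval (lw q) _) _
      rw [aeval_monomial]
      exact (Algebra.commute_algebraMap_left r (ld q)).mul_left (h.pow_left n)

theorem polyToLspec_d : polyToLspec u q (d u) = ld q := eval₂_X _ _

theorem polyToLspec_w : polyToLspec u q (w u) = lw q := by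
  refine (eval₂_C _ _).trans ?_
  change aeval (lw q) X = _
  rw [aeval_X]

theorem polyToLspec_algebraMap (r : ℂ) :
    polyToLspec u q (algebraMap ℂ (TwistedPoly u) r) = algebraMap ℂ (Lspec q) r := by
  refine (eval₂_C (R := ℂ[X]) (a := C r) _ _).trans ?_
  change aeval (lw q) (C r) = _
  rw [aeval_C]

theorem polyToLspec_smul (r : ℂ) (f : TwistedPoly u) :
    polyToLspec u q (r • f) = r • polyToLspec u q f := by
  rw [Algebra.smul_def, map_mul, polyToLspec_algebraMap, Algebra.smul_def]

theorem toTorus_polyToLspec (f : TwistedPoly (qInvSq hq)) :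
    toTorus hq (polyToLspec _ q f) = single 1 f := by
  induction f using TwistedPoly.induction with
  | scalar r => rw [polyToLspec_algebraMap, AlgHom.commutes]; rfl
  | hw => rw [polyToLspec_w, toTorus_lw]
  | hd => rw [polyToLspec_d, toTorus_ld]
  | add x y hx hy => rw [map_add, map_add, hx, hy, single_add]
  | mul x y hx hy => rw [map_mul, map_mul, hx, hy, single_mul_single, one_smul, one_mul]

theorem lb_mul_polyToLspec (f : TwistedPoly (qInvSq hq)) :
    lb q * polyToLspec _ q f = polyToLspec _ q (twist _ f) * lb q := by
  induction f using TwistedPoly.induction with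
  | scalar r => rw [AlgEquiv.commutes, polyToLspec_algebraMap, Algebra.commutes]
  | hw => rw [twist_w, polyToLspec_w, lw_mul_lb hq]
  | hd =>
    rw [twist_d, polyToLspec_smul, polyToLspec_d, smul_mul_assoc, ld_mul_lb_smul, smul_smul,
      coe_qInvSq, inv_mul_cancel₀ (pow_ne_zero 2 hq), one_smul]
  | add x y hx hy => simp only [map_add, mul_add, add_mul, hx, hy]
  | mul x y hx hy => rw [map_mul, ← mul_assoc, hx, mul_assoc, hy, map_mul, map_mul, mul_assoc]

theorem lc_mul_polyToLspec (f : TwistedPoly (qInvSq hq)) :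
    lc q * polyToLspec _ q f = polyToLspec _ q ((twist _).symm f) * lc q := by
  induction f using TwistedPoly.induction with
  | scalar r => rw [AlgEquiv.commutes, polyToLspec_algebraMap, Algebra.commutes]
  | hw => rw [twist_symm_w, polyToLspec_w, lw_mul_lc hq]
  | hd =>
    rw [twist_symm_d, polyToLspec_smul, polyToLspec_d, smul_mul_assoc, lc_mul_ld_smul,
      coe_qInvSq, inv_inv]
  | add x y hx hy => simp only [map_add, mul_add, add_mul, hx, hy]
  | mul x y hx hy => rw [map_mul, ← mul_assoc, hx, mul_assoc, hy, map_mul, map_mul, mul_assoc]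

theorem lc_mul_lb_eq : lc q * lb q = polyToLspec (qInvSq hq) q (p _) := by
  rw [p, lc_mul_lb hq, map_sub, map_sub, polyToLspec_smul, polyToLspec_smul, map_mul, map_mul,
    map_one, polyToLspec_d, polyToLspec_w, coe_qInvSq]

theorem lb_mul_lc_eq : lb q * lc q = polyToLspec (qInvSq hq) q (twist _ (p _)) := by
  rw [twist_p, lb_mul_lc hq, map_sub, map_sub, polyToLspec_smul, polyToLspec_smul,
    polyToLspec_smul, map_mul, map_mul, map_one, polyToLspec_d, polyToLspec_w, coe_qInvSq]

/-- The element of `𝓛(q)` of degree `n`: a power of `b` or of `c`. -/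
def gradedGen (q : ℂ) : ℤ → Lspec q
  | Int.ofNat n => lb q ^ n
  | Int.negSucc n => lc q ^ (n + 1)

theorem lb_mul_gradedGen (n : ℤ) :
    ∃ e, lb q * gradedGen q n = polyToLspec (qInvSq hq) q e * gradedGen q (n + 1) := by
  rcases n with n | n
  · refine ⟨1, ?_⟩
    rw [map_one, one_mul]
    exact (pow_succ' _ _).symm
  · refine ⟨twist _ (p _), ?_⟩
    rw [← lb_mul_lc_eq]
    change lb q * lc q ^ (n + 1) = _
    rw [pow_succ', ← mul_assoc]
    congr 1
    rcases n with _ | n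
    · exact (pow_zero (lc q)).trans (pow_zero (lb q)).symm
    · rfl

theorem lc_mul_gradedGen (n : ℤ) :
    ∃ e, lc q * gradedGen q n = polyToLspec (qInvSq hq) q e * gradedGen q (n - 1) := by
  rcases n with n | n
  · rcases n with _ | n
    · refine ⟨1, ?_⟩
      rw [map_one, one_mul]
      change lc q * lb q ^ 0 = lc q ^ 1
      rw [pow_zero, pow_one, mul_one]
    · refine ⟨p _, ?_⟩
      rw [← lc_mul_lb_eq]
      change lc q * lb q ^ (n + 1) = _
      rw [pow_succ', ← mul_assoc]
      congr 1
      rw [show Int.ofNat (n + 1) - 1 = Int.ofNat n by simp]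
      rfl
  · refine ⟨1, ?_⟩
    rw [map_one, one_mul]
    exact (pow_succ' _ _).symm

theorem toTorus_gradedGen (n : ℤ) :
    ∃ e : TwistedPoly (qInvSq hq), e ≠ 0 ∧
      toTorus hq (gradedGen q n) = single (Multiplicative.ofAdd n) e := by
  have key : ∀ (g : Multiplicative ℤ) (f : TwistedPoly (qInvSq hq)) (m : ℕ), f ≠ 0 →
      ∃ e : TwistedPoly (qInvSq hq), e ≠ 0 ∧ single g f ^ m = single (g ^ m) e := by
    intro g f m hf
    induction m with
    | zero => exact ⟨1, one_ne_zero, by rw [pow_zero, pow_zero, one_def]⟩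
    | succ m ih =>
      obtain ⟨e, he, h⟩ := ih
      refine ⟨e * g ^ m • f, mul_ne_zero he (by rwa [Ne, smul_eq_zero_iff_eq]), ?_⟩
      rw [pow_succ, h, single_mul_single, pow_succ]
  rcases n with n | n
  · obtain ⟨e, he, h⟩ := key (Multiplicative.ofAdd 1) 1 n one_ne_zero
    refine ⟨e, he, ?_⟩
    change toTorus hq (lb q ^ n) = _
    rw [map_pow, toTorus_lb, h, ← ofAdd_nsmul]
    simp
  · obtain ⟨e, he, h⟩ := key (Multiplicative.ofAdd (-1)) _ (n + 1) (p_ne_zero (qInvSq hq))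
    refine ⟨e, he, ?_⟩
    change toTorus hq (lc q ^ (n + 1)) = _
    rw [map_pow, toTorus_lc, h, ← ofAdd_nsmul]
    congr 2
    simp [Int.negSucc_eq]

/-- The sum of the `F n` times the homogeneous elements `gradedGen q n`. -/
def ofGraded : (ℤ →₀ TwistedPoly (qInvSq hq)) →+ Lspec q :=
  Finsupp.liftAddHom fun n =>
    (AddMonoidHom.mulRight (gradedGen q n)).comp (polyToLspec (qInvSq hq) q).toAddMonoidHom

theorem ofGraded_single (n : ℤ) (f : TwistedPoly (qInvSq hq)) :
    ofGraded hq (Finsupp.single n f) = polyToLspec _ q f * gradedGen q n := by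
  simp [ofGraded]

theorem ofGraded_surjective : Function.Surjective (ofGraded hq) := by
  have key : ∀ x : Lspec q, ∀ v ∈ (ofGraded hq).range, x * v ∈ (ofGraded hq).range := by
    have poly : ∀ f : TwistedPoly (qInvSq hq), ∀ v ∈ (ofGraded hq).range,
        polyToLspec _ q f * v ∈ (ofGraded hq).range := by
      rintro f _ ⟨F, rfl⟩
      induction F using Finsupp.induction_linear with
      | zero => simp
      | add F G hF hG => rw [map_add, mul_add]; exact add_mem hF hG
      | single n g =>
        exact ⟨Finsupp.single n (f * g), by
          rw [ofGraded_single, ofGraded_single, map_mul, mul_assoc]⟩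
    have hbc : ∀ (x : Lspec q) (τ : TwistedPoly (qInvSq hq) → TwistedPoly (qInvSq hq)) (m : ℤ),
        (∀ f, x * polyToLspec _ q f = polyToLspec _ q (τ f) * x) →
        (∀ n, ∃ e, x * gradedGen q n = polyToLspec (qInvSq hq) q e * gradedGen q (n + m)) →
        ∀ v ∈ (ofGraded hq).range, x * v ∈ (ofGraded hq).range := by
      rintro x τ m h1 h2 _ ⟨F, rfl⟩
      induction F using Finsupp.induction_linear with
      | zero => simp
      | add F G hF hG => rw [map_add, mul_add]; exact add_mem hF hG
      | single n g =>
        obtain ⟨e, he⟩ := h2 n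
        exact ⟨Finsupp.single (n + m) (τ g * e), by
          rw [ofGraded_single, ofGraded_single, map_mul, mul_assoc, ← he, ← mul_assoc, ← h1,
            mul_assoc]⟩
    intro x
    induction x using Lspec.induction with
    | scalar r => rw [← polyToLspec_algebraMap (qInvSq hq)]; exact poly _
    | ha =>
      have : la q = polyToLspec (qInvSq hq) q ((q ^ 2)⁻¹ • (w _ - d _)) := by
        rw [polyToLspec_smul, map_sub, polyToLspec_w, polyToLspec_d, la_eq hq]
      rw [this]
      exact poly _
    | hb => exact hbc _ _ 1 (lb_mul_polyToLspec hq) (lb_mul_gradedGen hq)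
    | hc => exact hbc _ _ (-1) (lc_mul_polyToLspec hq) (lc_mul_gradedGen hq)
    | hd => rw [← polyToLspec_d (qInvSq hq)]; exact poly _
    | add x y hx hy => intro v hv; rw [add_mul]; exact add_mem (hx v hv) (hy v hv)
    | mul x y hx hy => intro v hv; rw [mul_assoc]; exact hx _ (hy v hv)
  intro x
  have h1 : (1 : Lspec q) ∈ (ofGraded hq).range := by
    refine ⟨Finsupp.single 0 1, ?_⟩
    rw [ofGraded_single, map_one, one_mul]
    exact pow_zero _
  simpa using key x 1 h1

theorem toTorus_injective : Function.Injective (toTorus hq) := by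
  rw [injective_iff_map_eq_zero]
  intro x hx
  obtain ⟨F, rfl⟩ := ofGraded_surjective hq x
  choose e he he' using toTorus_gradedGen hq
  have key : ∀ F n, (toTorus hq (ofGraded hq F)).coeff (Multiplicative.ofAdd n) = F n * e n := by
    intro F n
    induction F using Finsupp.induction_linear with
    | zero => simp
    | add F G hF hG =>
      rw [map_add, map_add, SkewMonoidAlgebra.coeff_add, Finsupp.add_apply, hF, hG, Finsupp.add_apply, add_mul]
    | single m f =>
      rw [ofGraded_single, map_mul, toTorus_polyToLspec, he', single_mul_single, one_mul, one_smul,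
        SkewMonoidAlgebra.coeff_single]
      by_cases h : m = n
      · subst h
        simp
      · rw [Finsupp.single_eq_of_ne (by simpa using Ne.symm h), Finsupp.single_eq_of_ne (Ne.symm h),
          zero_mul]
  have hF : F = 0 := by
    ext n
    have := key F n
    rw [hx, SkewMonoidAlgebra.coeff_zero, Finsupp.zero_apply] at this
    exact (mul_eq_zero.1 this.symm).resolve_right (he n)
  rw [hF, map_zero]

theorem lspec_isDomain (hq : q ≠ 0) : IsDomain (Lspec q) := by
  have : Nontrivial (SkewTorus (qInvSq hq)) := inferInstance
  have : NoZeroDivisors (Lspec q) := (toTorus_injective hq).noZeroDivisors _ (map_zero _) (map_mul _)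
  have : Nontrivial (Lspec q) := (toTorus hq).toRingHom.domain_nontrivial
  exact NoZeroDivisors.to_isDomain _

theorem lb_ne_zero (hq : q ≠ 0) : lb q ≠ 0 := by
  intro h
  have := toTorus_lb hq
  rw [h, map_zero] at this
  exact one_ne_zero (single_eq_zero.1 this.symm)

theorem ld_ne_zero (hq : q ≠ 0) : ld q ≠ 0 := by
  intro h
  have := toTorus_ld hq
  rw [h, map_zero] at this
  exact X_ne_zero (R := ℂ[X]) (single_eq_zero.1 this.symm)

end Embedding

section RootOfUnity

variable {ε : ℂ} {l : ℕ}

theorem mul_lb_mul_lc_of_commute_ld (hq : ε ≠ 0) {x : Lspec ε} (hx : ld ε * x = x * ld ε) :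
    x * (lb ε * lc ε) = lb ε * lc ε * x := by
  have hw := Subring.mem_center_iff.1 (lw_mem_center hq) x
  have h1 : x * (lw ε * ld ε) = lw ε * ld ε * x := by
    rw [mul_assoc, hx, ← mul_assoc, hw, mul_assoc]
  have h2 : x * (ld ε * ld ε) = ld ε * ld ε * x := by
    rw [mul_assoc, hx, ← mul_assoc, ← hx, mul_assoc, ← hx]
  rw [lb_mul_lc hq]
  simp only [mul_sub, sub_mul, mul_smul_comm, smul_mul_assoc, h1, h2, mul_one, one_mul]

/-- An element that commutes with `b` and `d` is central. -/
theorem mem_center_of_commute_lb_ld (hq : ε ≠ 0) {x : Lspec ε} (hb : lb ε * x = x * lb ε)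
    (hd : ld ε * x = x * ld ε) : x ∈ Subring.center (Lspec ε) := by
  have := lspec_isDomain hq
  rw [Subring.mem_center_iff]
  intro g
  induction g using Lspec.induction with
  | scalar r => exact Algebra.commutes _ _
  | ha =>
    rw [la_eq hq, smul_mul_assoc, mul_smul_comm, sub_mul, mul_sub, hd,
      Subring.mem_center_iff.1 (lw_mem_center hq) x]
  | hb => exact hb
  | hc =>
    apply mul_left_cancel₀ (lb_ne_zero hq)
    rw [← mul_assoc, ← mul_lb_mul_lc_of_commute_ld hq hd, ← mul_assoc, ← mul_assoc, hb]
  | hd => exact hd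
  | add y z hy hz => rw [add_mul, mul_add, hy, hz]
  | mul y z hy hz => rw [mul_assoc, hz, ← mul_assoc, hy, mul_assoc]

theorem lb_pow_mem_center (hq : ε ≠ 0) (h : (ε ^ 2) ^ l = 1) :
    lb ε ^ l ∈ Subring.center (Lspec ε) := by
  refine mem_center_of_commute_lb_ld hq ((pow_succ' _ _).symm.trans (pow_succ _ _)) ?_
  rw [pow_mul_of_qcommute ld_mul_lb_smul, h, one_smul]

theorem ld_pow_mem_center (hq : ε ≠ 0) (h : (ε ^ 2) ^ l = 1) :
    ld ε ^ l ∈ Subring.center (Lspec ε) := by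
  refine mem_center_of_commute_lb_ld hq ?_ ((pow_succ' _ _).symm.trans (pow_succ _ _))
  rw [mul_pow_of_qcommute ld_mul_lb_smul, h, one_smul]

theorem algebraMap_mem_center (r : ℂ) :
    algebraMap ℂ (Lspec ε) r ∈ Subring.center (Lspec ε) :=
  Subring.mem_center_iff.2 fun g => (Algebra.commutes r g).symm

/-- The inclusion of `𝓛(ε)` into `Q(𝓛(ε))`. -/
def toQLL (ε : ℂ) : Lspec ε →ₐ[ZL ε] QLL ε := Algebra.TensorProduct.includeRight

theorem toQLL_of_mem_center {x : Lspec ε} (hx : x ∈ Subring.center (Lspec ε)) :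
    toQLL ε x = algebraMap (QZL ε) (QLL ε) (algebraMap (ZL ε) (QZL ε) ⟨x, hx⟩) := by
  rw [← IsScalarTower.algebraMap_apply]
  exact (toQLL ε).commutes (⟨x, hx⟩ : ZL ε)

/-- The scalar inclusion `ℂ → Q(Z)`. -/
def scalarToQZL (ε : ℂ) : ℂ →+* QZL ε :=
  (algebraMap (ZL ε) (QZL ε)).comp
    ((algebraMap ℂ (Lspec ε)).codRestrict (Subring.center (Lspec ε)) algebraMap_mem_center)

theorem toQLL_smul (r : ℂ) (x : Lspec ε) : toQLL ε (r • x) = scalarToQZL ε r • toQLL ε x := by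
  rw [Algebra.smul_def, map_mul, toQLL_of_mem_center (algebraMap_mem_center r)]
  exact (Algebra.smul_def _ _).symm

theorem adjoin_toQLL_eq_top (hq : ε ≠ 0) (h : (ε ^ 2) ^ l = 1) (hl : 0 < l) :
    Algebra.adjoin (QZL ε) {toQLL ε (lb ε), toQLL ε (ld ε)} = ⊤ := by
  have := lspec_isDomain hq
  set S := Algebra.adjoin (QZL ε) {toQLL ε (lb ε), toQLL ε (ld ε)} with hS
  have hb : toQLL ε (lb ε) ∈ S := Algebra.subset_adjoin (by simp)
  have hd : toQLL ε (ld ε) ∈ S := Algebra.subset_adjoin (by simp)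
  have hcen : ∀ x ∈ Subring.center (Lspec ε), toQLL ε x ∈ S := fun x hx => by
    rw [toQLL_of_mem_center hx]
    exact S.algebraMap_mem _
  have hw := hcen _ (lw_mem_center hq)
  have key : ∀ x : Lspec ε, toQLL ε x ∈ S := by
    intro x
    induction x using Lspec.induction with
    | scalar r => exact hcen _ (algebraMap_mem_center r)
    | ha =>
      rw [la_eq hq, toQLL_smul, map_sub]
      exact S.smul_mem (S.sub_mem hw hd) _
    | hb => exact hb
    | hc =>
      have hbc : toQLL ε (lb ε * lc ε) ∈ S := by
        rw [lb_mul_lc hq, map_sub, map_sub, toQLL_smul, toQLL_smul, toQLL_smul, map_mul, map_mul,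
          map_one]
        exact S.sub_mem (S.sub_mem (S.smul_mem (S.mul_mem hw hd) _)
          (S.smul_mem (S.mul_mem hd hd) _)) (S.smul_mem S.one_mem _)
      have hblc : toQLL ε (lb ε ^ l * lc ε) ∈ S := by
        obtain ⟨m, rfl⟩ : ∃ m, l = m + 1 := ⟨l - 1, by omega⟩
        rw [pow_succ, mul_assoc, map_mul, map_pow]
        exact S.mul_mem (S.pow_mem hb _) hbc
      have hβ := lb_pow_mem_center hq h
      have hβ0 : algebraMap (ZL ε) (QZL ε) ⟨lb ε ^ l, hβ⟩ ≠ 0 := by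
        rw [Ne, map_eq_zero_iff _ (IsFractionRing.injective (ZL ε) (QZL ε))]
        exact fun h0 => pow_ne_zero l (lb_ne_zero hq) (congrArg Subtype.val h0)
      rw [map_mul, toQLL_of_mem_center hβ, ← Algebra.smul_def] at hblc
      have := S.smul_mem hblc (algebraMap (ZL ε) (QZL ε) ⟨lb ε ^ l, hβ⟩)⁻¹
      rwa [smul_smul, inv_mul_cancel₀ hβ0, one_smul] at this
    | hd => exact hd
    | add y z hy hz => rw [map_add]; exact S.add_mem hy hz
    | mul y z hy hz => rw [map_mul]; exact S.mul_mem hy hz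
  rw [eq_top_iff]
  intro x _
  obtain ⟨z, a, hz, hx⟩ := centralLocalization_surj (Lspec ε) x
  have hz0 : algebraMap (ZL ε) (QZL ε) z ≠ 0 := by
    rwa [Ne, map_eq_zero_iff _ (IsFractionRing.injective (ZL ε) (QZL ε))]
  have ha : algebraMap (ZL ε) (QZL ε) z • x ∈ S := by
    have hx' : algebraMap (ZL ε) (QZL ε) z • x = toQLL ε a := (Algebra.smul_def _ _).trans hx
    rw [hx']
    exact key a
  have := S.smul_mem ha (algebraMap (ZL ε) (QZL ε) z)⁻¹
  rwa [smul_smul, inv_mul_cancel₀ hz0, one_smul] at this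

theorem exists_basis_QLL (hε : IsPrimitiveRoot ε l) (hodd : Odd l) :
    Nonempty (Module.Basis (Fin l × Fin l) (QZL ε) (QLL ε)) := by
  have hl : 0 < l := hodd.pos
  have hq : ε ≠ 0 := hε.ne_zero hl.ne'
  have := lspec_isDomain hq
  have := centralLocalization_isDomain (Lspec ε)
  have hs : IsPrimitiveRoot (ε ^ 2) l := hε.pow_of_coprime 2 (Nat.coprime_two_left.2 hodd)
  have hinj : Function.Injective (toQLL ε) := centralLocalization_injective (Lspec ε)
  refine ⟨basisOfQCommute hl (hs.map_of_injective (scalarToQZL ε).injective)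
    (x := toQLL ε (lb ε)) (y := toQLL ε (ld ε)) ?_
    ((map_pow _ _ _).symm.trans (toQLL_of_mem_center (lb_pow_mem_center hq hs.pow_eq_one)))
    ((map_pow _ _ _).symm.trans (toQLL_of_mem_center (ld_pow_mem_center hq hs.pow_eq_one)))
    ?_ ?_ (adjoin_toQLL_eq_top hq hs.pow_eq_one hl)⟩
  · rw [← map_mul, ld_mul_lb_smul, toQLL_smul, map_mul]
  · rw [Ne, map_eq_zero_iff _ hinj]
    exact lb_ne_zero hq
  · rw [Ne, map_eq_zero_iff _ hinj]
    exact ld_ne_zero hq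

theorem isSimpleRing_of_forall_isUnit {A : Type*} [Ring A] [Nontrivial A]
    (h : ∀ x : A, x ≠ 0 → IsUnit x) : IsSimpleRing A := by
  let : DivisionRing A := DivisionRing.ofIsUnitOrEqZero fun x => (em (x = 0)).elim .inr (.inl ∘ h x)
  exact inferInstance

end RootOfUnity

/-- Let `l ≥ 3` be odd and `ε` a primitive `l`-th root of unity.  Then 𝓛(ε) has
no nontrivial zero divisors; moreover, writing `Z` for the center of 𝓛(ε) and `Q(Z)` for its
fraction field, the algebra `Q(𝓛(ε)) := Q(Z) ⊗_Z 𝓛(ε)` is a central simple algebra over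
`Q(Z)` (its center equals `Q(Z)` and it is a simple ring) of dimension `l²` as a
`Q(Z)`-vector space; equivalently, `Q(𝓛(ε))` is a division algebra (of PI degree `l`). -/
theorem stmt_9 (l : ℕ) (hodd : Odd l) (hl : 3 ≤ l) (ε : ℂ) (hε : IsPrimitiveRoot ε l) :
    IsDomain (Lspec ε) ∧
    Subring.center (QLL ε) = (algebraMap (QZL ε) (QLL ε)).range ∧
    IsSimpleRing (QLL ε) ∧
    Module.rank (QZL ε) (QLL ε) = (l : Cardinal) ^ 2 ∧
    (∀ x : QLL ε, x ≠ 0 → IsUnit x) := by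
  have hq : ε ≠ 0 := hε.ne_zero (by omega)
  have := lspec_isDomain hq
  have := centralLocalization_isDomain (Lspec ε)
  obtain ⟨B⟩ := exists_basis_QLL hε hodd
  have : FiniteDimensional (QZL ε) (QLL ε) := B.finiteDimensional_of_finite
  have hunit : ∀ x : QLL ε, x ≠ 0 → IsUnit x := fun x hx => FiniteDimensional.isUnit (QZL ε) hx
  refine ⟨inferInstance, center_centralLocalization (Lspec ε),
    isSimpleRing_of_forall_isUnit hunit, ?_, hunit⟩
  rw [rank_eq_card_basis B]
  simp [sq]

end
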